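/- Free groups are generalized torsion-free: for any type α, if g is a nontrivial element of the free group on α (g ≠ 1), n ≥ 1, and h_1, …, h_n are elements of the free group on α, then the product (h_1^{-1} g h_1)·(h_2^{-1} g h_2)⋯(h_n^{-1} g h_n) is not equal to 1. -/

import Mathlib

/-- Let `I` be a decreasing multiplicative filtration of a ring with torsion-free quotients. A group
acting by elements congruent to `1` modulo `I 1` has no generalized torsion outside the elements
acting trivially modulo every `I k`. -/
theorem prod_conj_ne_one_of_filtration {R G : Type*} [Ring R] [Group G]
    (I : ℕ → AddSubgroup R) (anti : Antitone I)
    (mul_mem : ∀ {a b x y}, x ∈ I a → y ∈ I b → x * y ∈ I (a + b))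
    (mem_of_nsmul : ∀ {d n x}, n ≠ 0 → n • x ∈ I d → x ∈ I d)
    (ρ : G →* R) (hρ : ∀ g, ρ g - 1 ∈ I 1) {g : G} {k : ℕ} (hk : ρ g - 1 ∉ I k)
    {n : ℕ} (hn : n ≠ 0) (h : Fin n → G) :
    (List.ofFn (fun i => (h i)⁻¹ * g * h i)).prod ≠ 1 := by
  intro hprod
  have key : ∀ d, ρ g - 1 ∈ I (d + 1) := by
    intro d
    induction d with
    | zero => exact hρ g
    | succ d ih =>
      have conj : ∀ u : G, ρ (u⁻¹ * g * u) - 1 - (ρ g - 1) ∈ I (d + 1 + 1) := by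
        intro u
        have hu : ρ u⁻¹ * ρ u = 1 := by rw [← map_mul, inv_mul_cancel, map_one]
        have e : ρ (u⁻¹ * g * u) - 1 - (ρ g - 1) =
            (ρ u⁻¹ - 1) * (ρ g - 1) + (ρ g - 1) * (ρ u - 1) +
              (ρ u⁻¹ - 1) * (ρ g - 1) * (ρ u - 1) := by
          have e' : (ρ u⁻¹ - 1) * (ρ g - 1) + (ρ g - 1) * (ρ u - 1) +
              (ρ u⁻¹ - 1) * (ρ g - 1) * (ρ u - 1) =
              ρ u⁻¹ * ρ g * ρ u - ρ u⁻¹ * ρ u - (ρ g - 1) := by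
            noncomm_ring
          rw [e', hu, map_mul, map_mul]
        rw [e]
        refine add_mem (add_mem ?_ (mul_mem ih (hρ u))) ?_
        · exact anti (by omega) (mul_mem (hρ u⁻¹) ih)
        · exact anti (by omega) (mul_mem (mul_mem (hρ u⁻¹) ih) (hρ u))
      have prod : ∀ l : List G,
          ρ (l.map fun u => u⁻¹ * g * u).prod - 1 - l.length • (ρ g - 1) ∈ I (d + 1 + 1) := by
        intro l
        induction l with
        | nil => simp
        | cons u l ihl =>
          rw [List.map_cons, List.prod_cons, map_mul, List.length_cons, succ_nsmul]
          set a := ρ (u⁻¹ * g * u)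
          set b := ρ (l.map fun u => u⁻¹ * g * u).prod
          have ha : a - 1 ∈ I (d + 1) := by
            simpa only [sub_add_cancel] using add_mem (anti (by omega) (conj u)) ih
          have hb : b - 1 ∈ I (d + 1) := by
            simpa only [sub_add_cancel] using add_mem (anti (by omega) ihl) (nsmul_mem ih l.length)
          have e : a * b - 1 - (l.length • (ρ g - 1) + (ρ g - 1)) =
              (a - 1 - (ρ g - 1)) + (b - 1 - l.length • (ρ g - 1)) + (a - 1) * (b - 1) := by
            noncomm_ring
          rw [e]
          exact add_mem (add_mem (conj u) ihl) (anti (by omega) (mul_mem ha hb))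
      have hp := prod (List.ofFn h)
      rw [List.map_ofFn] at hp
      change ρ (List.ofFn (fun i => (h i)⁻¹ * g * h i)).prod - 1 - _ ∈ _ at hp
      rw [hprod, map_one, sub_self, zero_sub, neg_mem_iff, List.length_ofFn] at hp
      exact mem_of_nsmul hn hp
  exact hk (anti (Nat.le_succ k) (key k))

/-- Every element of a free group is a product of nonzero powers of generators, consecutive
generators being distinct. -/
theorem FreeGroup.exists_syllables {α : Type*} (g : FreeGroup α) :
    ∃ l : List (α × ℤ), (l.map fun p => FreeGroup.of p.1 ^ p.2).prod = g ∧
      (∀ p ∈ l, p.2 ≠ 0) ∧ l.IsChain fun p q => p.1 ≠ q.1 := by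
  classical
  let forth : FreeGroup α →* Monoid.CoprodI fun _ : α => Multiplicative ℤ :=
    FreeGroup.lift fun i => Monoid.CoprodI.of (i := i) (Multiplicative.ofAdd 1)
  let back : (Monoid.CoprodI fun _ : α => Multiplicative ℤ) →* FreeGroup α :=
    Monoid.CoprodI.lift fun i => zpowersHom _ (FreeGroup.of i)
  have hbf : back.comp forth = MonoidHom.id _ := by
    ext i
    simp [forth, back]
  let w := Monoid.CoprodI.Word.equiv (forth g)
  have hw : w.prod = forth g := Monoid.CoprodI.Word.equiv.symm_apply_apply (forth g)
  refine ⟨w.toList.map fun p => (p.1, p.2.toAdd), ?_, ?_, ?_⟩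
  · have hg : back (forth g) = g := DFunLike.congr_fun hbf g
    rw [← hw, Monoid.CoprodI.Word.prod, map_list_prod] at hg
    rw [← hg, List.map_map, List.map_map]
    congr 1
  · intro p hp
    obtain ⟨q, hq, rfl⟩ := List.mem_map.1 hp
    exact fun h0 => w.ne_one q hq (toAdd_eq_zero.1 h0)
  · rw [List.isChain_map]
    exact w.chain_ne

/-- Operators on integer sequences `f` whose value at `j` depends only on the terms of `f` of index
at least `j + d`. -/
def shiftFiltration (d : ℕ) : AddSubgroup (Module.End ℤ (ℕ → ℤ)) where
  carrier := {T | ∀ f j, (∀ m, j + d ≤ m → f m = 0) → T f j = 0}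
  zero_mem' := fun _ _ _ => rfl
  add_mem' := fun {S T} hS hT f j hf => by simp [hS f j hf, hT f j hf]
  neg_mem' := fun {S} hS f j hf => by simp [hS f j hf]

theorem mem_shiftFiltration {d : ℕ} {T : Module.End ℤ (ℕ → ℤ)} :
    T ∈ shiftFiltration d ↔ ∀ f j, (∀ m, j + d ≤ m → f m = 0) → T f j = 0 :=
  Iff.rfl

theorem shiftFiltration_antitone : Antitone shiftFiltration :=
  fun _ _ hab _ hT f j hf => hT f j fun m hm => hf m (by omega)

theorem mul_mem_shiftFiltration {a b : ℕ} {S T : Module.End ℤ (ℕ → ℤ)}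
    (hS : S ∈ shiftFiltration a) (hT : T ∈ shiftFiltration b) :
    S * T ∈ shiftFiltration (a + b) :=
  fun f j hf => hS (T f) j fun m hm => hT f m fun m' hm' => hf m' (by omega)

theorem mem_shiftFiltration_of_nsmul {d n : ℕ} {T : Module.End ℤ (ℕ → ℤ)} (hn : n ≠ 0)
    (h : n • T ∈ shiftFiltration d) : T ∈ shiftFiltration d := by
  intro f j hf
  simpa [hn] using h f j hf

section LabelledShift

variable {α : Type*} [DecidableEq α] (a : ℕ → Option α)

/-- The backward shift of integer sequences, restricted to the positions labelled `i` by `a`. -/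
def labelledShift (i : α) : Module.End ℤ (ℕ → ℤ) where
  toFun f j := if a j = some i then f (j + 1) else 0
  map_add' f g := by ext j; by_cases h : a j = some i <;> simp [h]
  map_smul' c f := by ext j; by_cases h : a j = some i <;> simp [h]

theorem labelledShift_apply (i : α) (f : ℕ → ℤ) (j : ℕ) :
    labelledShift a i f j = if a j = some i then f (j + 1) else 0 :=
  rfl

theorem labelledShift_mem_shiftFiltration (i : α) : labelledShift a i ∈ shiftFiltration 1 := by
  intro f j hf
  simp [labelledShift_apply, hf (j + 1) le_rfl]

variable {a}

theorem labelledShift_mul_self (ha : ∀ i j, a j = some i → a (j + 1) ≠ some i) (i : α) :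
    labelledShift a i * labelledShift a i = 0 := by
  ext1 f
  ext j
  have := ha i j
  simp only [Module.End.mul_apply, labelledShift_apply]
  split_ifs <;> simp_all

variable (ha : ∀ i j, a j = some i → a (j + 1) ≠ some i)

/-- The unipotent representation of a free group sending a generator `i` to
`1 + labelledShift a i`. -/
def shiftRep : FreeGroup α →* Module.End ℤ (ℕ → ℤ) :=
  (Units.coeHom _).comp <| FreeGroup.lift fun i =>
    { val := 1 + labelledShift a i
      inv := 1 - labelledShift a i
      val_inv := by
        simp [mul_sub, add_mul, labelledShift_mul_self ha]
      inv_val := by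
        simp [mul_add, sub_mul, labelledShift_mul_self ha] }

theorem shiftRep_of (i : α) : shiftRep ha (FreeGroup.of i) = 1 + labelledShift a i := by
  simp [shiftRep]

theorem shiftRep_of_inv (i : α) : shiftRep ha (FreeGroup.of i)⁻¹ = 1 - labelledShift a i := by
  simp [shiftRep]

theorem shiftRep_of_zpow (i : α) (e : ℤ) :
    shiftRep ha (FreeGroup.of i ^ e) = 1 + e • labelledShift a i := by
  induction e with
  | zero => simp
  | succ e ih =>
    rw [zpow_add_one, map_mul, ih, shiftRep_of, mul_add, mul_one, add_mul, one_mul, smul_mul_assoc,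
      labelledShift_mul_self ha, add_smul]
    simp [add_assoc]
  | pred e ih =>
    rw [zpow_sub_one, map_mul, ih, shiftRep_of_inv, mul_sub, mul_one, add_mul, one_mul, smul_mul_assoc,
      labelledShift_mul_self ha, sub_smul]
    simp [add_sub_assoc]

theorem shiftRep_sub_one_mem (g : FreeGroup α) : shiftRep ha g - 1 ∈ shiftFiltration 1 := by
  induction g using FreeGroup.induction_on with
  | C1 => simp
  | of i => simpa [shiftRep_of] using labelledShift_mem_shiftFiltration a i
  | inv_of i _ => simpa [shiftRep_of_inv] using labelledShift_mem_shiftFiltration a i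
  | mul x y hx hy =>
    have e : shiftRep ha (x * y) - 1 = (shiftRep ha x - 1) + (shiftRep ha y - 1) +
        (shiftRep ha x - 1) * (shiftRep ha y - 1) := by
      rw [map_mul]
      noncomm_ring
    rw [e]
    exact add_mem (add_mem hx hy)
      (shiftFiltration_antitone (by omega) (mul_mem_shiftFiltration hx hy))

theorem shiftRep_syllables_apply (l : List (α × ℤ)) (hl : ∀ p ∈ l, p.2 ≠ 0) (m : ℕ)
    (hal : ∀ j (hj : j < l.length), a (m + j) = some l[j].1) :
    let f := shiftRep ha (l.map fun p => FreeGroup.of p.1 ^ p.2).prod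
      (Pi.single (m + l.length) 1)
    (∀ j < m, f j = 0) ∧ f m ≠ 0 := by
  induction l generalizing m with
  | nil =>
    simp only [List.map_nil, List.prod_nil, map_one, Module.End.one_apply, List.length_nil,
      add_zero]
    exact ⟨fun j hj => Pi.single_eq_of_ne (by omega) _, by simp⟩
  | cons p l ih =>
    obtain ⟨h0, h1⟩ := ih (fun q hq => hl q (List.mem_cons_of_mem _ hq)) (m + 1) fun j hj => by
      rw [add_assoc, add_comm 1 j]
      exact hal (j + 1) (by simpa using hj)
    have ham : a m = some p.1 := hal 0 (by simp)
    have hlen : m + (p :: l).length = m + 1 + l.length := by simp; omega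
    simp only [hlen, List.map_cons, List.prod_cons, map_mul, Module.End.mul_apply]
    set f := shiftRep ha (l.map fun p => FreeGroup.of p.1 ^ p.2).prod
      (Pi.single (m + 1 + l.length) 1)
    have hf : ∀ j, shiftRep ha (FreeGroup.of p.1 ^ p.2) f j =
        f j + p.2 * if a j = some p.1 then f (j + 1) else 0 := fun j => by
      rw [shiftRep_of_zpow]
      rfl
    refine ⟨fun j hj => ?_, ?_⟩
    · simp [hf, h0 j (by omega), h0 (j + 1) (by omega)]
    · rw [hf, if_pos ham, h0 m (by omega), zero_add]
      exact mul_ne_zero (hl p (by simp)) h1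

end LabelledShift

/-- Free groups are generalized torsion-free: if `g ≠ 1` in `FreeGroup α` and
`n ≥ 1`, then `(h 1)⁻¹ * g * (h 1) * ⋯ * (h n)⁻¹ * g * (h n) ≠ 1`. -/
theorem freeGroup_generalized_torsion_free {α : Type*}
    (g : FreeGroup α) (hg : g ≠ 1) (n : ℕ) (hn : 1 ≤ n)
    (h : Fin n → FreeGroup α) :
    (List.ofFn (fun i => (h i)⁻¹ * g * h i)).prod ≠ 1 := by
  classical
  obtain ⟨l, rfl, hl, hchain⟩ := g.exists_syllables
  have ha : ∀ i j, l[j]?.map Prod.fst = some i → l[j + 1]?.map Prod.fst ≠ some i := by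
    intro i j h1 h2
    simp only [Option.map_eq_some_iff, List.getElem?_eq_some_iff] at h1 h2
    obtain ⟨_, ⟨hj, rfl⟩, rfl⟩ := h1
    obtain ⟨_, ⟨hj', rfl⟩, h2⟩ := h2
    exact List.isChain_iff_getElem.1 hchain j hj' h2.symm
  have hlen : 0 ≠ l.length := fun h0 => hg (by simp [List.length_eq_zero_iff.1 h0.symm])
  refine prod_conj_ne_one_of_filtration shiftFiltration shiftFiltration_antitone
    mul_mem_shiftFiltration mem_shiftFiltration_of_nsmul (shiftRep ha) (shiftRep_sub_one_mem ha)
    (k := l.length + 1) (fun hmem => ?_) (by omega) h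
  refine (shiftRep_syllables_apply ha l hl 0 fun j hj => by simp [hj]).2 ?_
  have := hmem (Pi.single l.length 1) 0 fun m hm => Pi.single_eq_of_ne (by omega) _
  simpa [Pi.single_eq_of_ne hlen] using this
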